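/- Let p>1, let N≥1 be an integer, and let w:[0,1]→ℝ be continuous with w(r)>0 for all r∈[0,1]. Then: (a) there exists a principal eigenpair (λ_w,v_w) for the weight w; (b) if (μ,v) is any pair with μ∈ℝ, v∈C^1([0,1],ℝ), φ_p∘v'∈C^1([0,1],ℝ), v≢0, v(r)>0 for all r∈[0,1), satisfying −(d/dr)(r^{N−1}φ_p(v'(r))) = μ r^{N−1} w(r) φ_p(v(r)) on (0,1) with v'(0)=v(1)=0, then μ=λ_w; (c) if w_1,w_2:[0,1]→ℝ are continuous, positive on [0,1], with w_2(r)≤w_1(r) for all r and w_2≢w_1, then the corresponding principal eigenvalues satisfy λ_{w_1}<λ_{w_2}. -/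

import Mathlib

open Set MeasureTheory Filter Topology intervalIntegral

noncomputable section

/-- `phi p ξ = |ξ|^(p-2) ξ`, the function `φ_p`. -/
def phi (p ξ : ℝ) : ℝ := |ξ| ^ (p - 2) * ξ

/-- The (one-sided at endpoints) derivative of a function on `[0,1]`. -/
def deriv01 (u : ℝ → ℝ) (r : ℝ) : ℝ := derivWithin u (Set.Icc 0 1) r

/-- `u ∈ C^1([0,1],ℝ)`. -/
def C1on01 (u : ℝ → ℝ) : Prop :=
  (∀ r ∈ Set.Icc (0:ℝ) 1, DifferentiableWithinAt ℝ u (Set.Icc 0 1) r) ∧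
  ContinuousOn (deriv01 u) (Set.Icc 0 1)

/-- `J(h)(s) = ∫_0^s (t/s)^(N-1) h(t) dt`, with `J(h)(0) = 0`. -/
def Jmap (N : ℕ) (h : ℝ → ℝ) (s : ℝ) : ℝ :=
  if s = 0 then 0 else ∫ t in (0:ℝ)..s, (t / s) ^ (N - 1) * h t

/-- `S_p(h)(r) = ∫_r^1 φ_{p'}(J(h)(s)) ds` where `p' = p/(p-1)`. -/
def Sp (p : ℝ) (N : ℕ) (h : ℝ → ℝ) (r : ℝ) : ℝ :=
  ∫ s in r..(1:ℝ), phi (p / (p - 1)) (Jmap N h s)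

/-- The sup norm over `[0,1]`. -/
def norm0 (h : ℝ → ℝ) : ℝ := sSup ((fun t => |h t|) '' Set.Icc 0 1)

/-- `u` is not identically zero on `[0,1]`. -/
def Nontriv01 (u : ℝ → ℝ) : Prop := ∃ r ∈ Set.Icc (0:ℝ) 1, u r ≠ 0

/-- `(lam, u)` is a solution of problem (P):
`-(r^(N-1) φ_p(u'))' = lam r^(N-1) f(r, u(r))` on `(0,1)`, `u'(0) = u(1) = 0`. -/
def IsSolutionP (p : ℝ) (N : ℕ) (f : ℝ → ℝ → ℝ) (lam : ℝ) (u : ℝ → ℝ) : Prop :=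
  C1on01 u ∧ C1on01 (fun r => phi p (deriv01 u r)) ∧
  (∀ r ∈ Set.Ioo (0:ℝ) 1,
      HasDerivAt (fun s => s ^ (N - 1) * phi p (deriv01 u s))
        (-(lam * r ^ (N - 1) * f r (u r))) r) ∧
  deriv01 u 0 = 0 ∧ u 1 = 0

/-- `(lam, v)` is a principal eigenpair for the weight `w`. -/
def IsPrincipalEigenpair (p : ℝ) (N : ℕ) (w : ℝ → ℝ) (lam : ℝ) (v : ℝ → ℝ) : Prop :=
  0 < lam ∧ C1on01 v ∧ C1on01 (fun r => phi p (deriv01 v r)) ∧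
  (∀ r ∈ Set.Ico (0:ℝ) 1, 0 < v r) ∧
  (∀ r ∈ Set.Ioo (0:ℝ) 1,
      HasDerivAt (fun s => s ^ (N - 1) * phi p (deriv01 v s))
        (-(lam * r ^ (N - 1) * w r * phi p (v r))) r) ∧
  deriv01 v 0 = 0 ∧ v 1 = 0

/-- `∫_0^1 τ^n h(sτ) dτ`; for `s > 0` this is `s^(-(n+1)) ∫_0^s t^n h(t) dt`. -/
def radialMean (n : ℕ) (h : ℝ → ℝ) (s : ℝ) : ℝ := ∫ τ in (0:ℝ)..1, τ ^ n * h (s * τ)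

/-- `∫_r^1 (s^(-n) ∫_0^s t^n h(t) dt)^(1/α) ds`, the inverse of the radial `(α+1)`-Laplacian. -/
def radialPotential (α : ℝ) (n : ℕ) (h : ℝ → ℝ) (r : ℝ) : ℝ :=
  ∫ s in r..(1:ℝ), (s * radialMean n h s) ^ α⁻¹

section RadialMean

variable {n : ℕ} {h g : ℝ → ℝ}

lemma continuous_radialMean (hh : Continuous h) : Continuous (radialMean n h) := by
  unfold radialMean
  apply continuous_parametric_intervalIntegral_of_continuous'
  fun_prop

lemma mul_mem_unit {s τ : ℝ} (hs : s ∈ Icc (0:ℝ) 1) (hτ : τ ∈ Icc (0:ℝ) 1) :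
    s * τ ∈ Icc (0:ℝ) 1 :=
  ⟨mul_nonneg hs.1 hτ.1, mul_le_one₀ hs.2 hτ.1 hτ.2⟩

lemma radialMean_congr (hgh : EqOn h g (Icc 0 1)) {s : ℝ} (hs : s ∈ Icc (0:ℝ) 1) :
    radialMean n h s = radialMean n g s := by
  unfold radialMean
  refine intervalIntegral.integral_congr fun τ hτ => ?_
  rw [uIcc_of_le zero_le_one] at hτ
  simp only [hgh (mul_mem_unit hs hτ)]

lemma radialMean_mono (hh : Continuous h) (hg : Continuous g)
    (hle : ∀ t ∈ Icc (0:ℝ) 1, h t ≤ g t) {s : ℝ} (hs : s ∈ Icc (0:ℝ) 1) :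
    radialMean n h s ≤ radialMean n g s := by
  unfold radialMean
  refine intervalIntegral.integral_mono_on zero_le_one
    (Continuous.intervalIntegrable (by fun_prop) _ _)
    (Continuous.intervalIntegrable (by fun_prop) _ _) fun τ hτ => ?_
  exact mul_le_mul_of_nonneg_left (hle _ (mul_mem_unit hs hτ)) (pow_nonneg hτ.1 _)

lemma radialMean_nonneg (hh0 : ∀ t ∈ Icc (0:ℝ) 1, 0 ≤ h t) {s : ℝ}
    (hs : s ∈ Icc (0:ℝ) 1) : 0 ≤ radialMean n h s :=
  intervalIntegral.integral_nonneg zero_le_one fun _ hτ =>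
    mul_nonneg (pow_nonneg hτ.1 _) (hh0 _ (mul_mem_unit hs hτ))

lemma radialMean_le (hh : Continuous h) {M : ℝ} (hM0 : 0 ≤ M)
    (hM : ∀ t ∈ Icc (0:ℝ) 1, h t ≤ M) {s : ℝ} (hs : s ∈ Icc (0:ℝ) 1) :
    radialMean n h s ≤ M := by
  have key : radialMean n h s ≤ ∫ _τ in (0:ℝ)..1, M := by
    unfold radialMean
    refine intervalIntegral.integral_mono_on zero_le_one
      (Continuous.intervalIntegrable (by fun_prop) _ _)
      (Continuous.intervalIntegrable (by fun_prop) _ _) fun τ hτ => ?_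
    calc τ ^ n * h (s * τ) ≤ τ ^ n * M :=
          mul_le_mul_of_nonneg_left (hM _ (mul_mem_unit hs hτ)) (pow_nonneg hτ.1 _)
      _ ≤ 1 * M := mul_le_mul_of_nonneg_right (pow_le_one₀ hτ.1 hτ.2) hM0
      _ = M := one_mul M
  simpa using key

lemma radialMean_const_mul (c : ℝ) (s : ℝ) :
    radialMean n (fun t => c * h t) s = c * radialMean n h s := by
  unfold radialMean
  rw [← intervalIntegral.integral_const_mul]
  congr 1
  ext τ
  ring

lemma exists_mem_Ioo_of_lt {h g : ℝ → ℝ} (hh : Continuous h) (hg : Continuous g) {r : ℝ}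
    (hr : r ∈ Icc (0:ℝ) 1) (hlt : h r < g r) : ∃ t ∈ Ioo (0:ℝ) 1, h t < g t := by
  rw [← closure_Ioo zero_ne_one] at hr
  obtain ⟨t, ht, ht'⟩ := mem_closure_iff.1 hr _ (isOpen_lt hh hg) hlt
  exact ⟨t, ht', ht⟩

lemma radialMean_one_lt (hh : Continuous h) (hg : Continuous g)
    (hle : ∀ t ∈ Icc (0:ℝ) 1, h t ≤ g t) (hlt : ∃ t ∈ Icc (0:ℝ) 1, h t < g t) :
    radialMean n h 1 < radialMean n g 1 := by
  obtain ⟨r, hr, hlt⟩ := hlt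
  obtain ⟨t, ht, hlt⟩ := exists_mem_Ioo_of_lt hh hg hr hlt
  simp only [radialMean, one_mul]
  refine intervalIntegral.integral_lt_integral_of_continuousOn_of_le_of_exists_lt zero_lt_one
    (Continuous.continuousOn (by fun_prop)) (Continuous.continuousOn (by fun_prop))
    (fun τ hτ => ?_) ⟨t, Ioo_subset_Icc_self ht, ?_⟩
  · exact mul_le_mul_of_nonneg_left (hle _ (Ioc_subset_Icc_self hτ)) (pow_nonneg hτ.1.le _)
  · exact mul_lt_mul_of_pos_left hlt (pow_pos ht.1 _)

lemma pow_mul_mul_radialMean (s : ℝ) :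
    s ^ n * (s * radialMean n h s) = ∫ t in (0:ℝ)..s, t ^ n * h t := by
  have := intervalIntegral.mul_integral_comp_mul_left (a := 0) (b := 1)
    (f := fun t => t ^ n * h t) s
  simp only [mul_zero, mul_one] at this
  rw [← this, radialMean, mul_left_comm, ← intervalIntegral.integral_const_mul]
  congr 2
  ext
  ring

/-- The flux `s ↦ s^(-n) ∫_0^s t^n h(t) dt` is continuously differentiable, even at `0`. -/
lemma hasDerivAt_mul_radialMean (hh : Continuous h) (s : ℝ) :
    HasDerivAt (fun s => s * radialMean n h s) (h s - n * radialMean n h s) s := by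
  have hc := continuous_radialMean (n := n) hh
  have key : ∀ y : ℝ, y ≠ 0 →
      HasDerivAt (fun s => s * radialMean n h s) (h y - n * radialMean n h y) y := by
    intro y hy
    have h1 : HasDerivAt (fun s => ∫ t in (0:ℝ)..s, t ^ n * h t) (y ^ n * h y) y :=
      (Continuous.integral_hasStrictDerivAt (f := fun t => t ^ n * h t) (by fun_prop) 0 y).hasDerivAt
    have h2 := h1.div (hasDerivAt_pow n y) (pow_ne_zero n hy)
    have h3 : HasDerivAt (fun s => s * radialMean n h s) _ y :=
      h2.congr_of_eventuallyEq (by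
        filter_upwards [isOpen_ne.mem_nhds hy] with s hs
        rw [Pi.div_apply, ← pow_mul_mul_radialMean,
          mul_div_cancel_left₀ _ (pow_ne_zero n hs)])
    convert h3 using 1
    rw [← pow_mul_mul_radialMean]
    rcases n with _ | n
    · simp
    · have := pow_ne_zero n hy
      simp only [Nat.add_sub_cancel]
      field_simp
      ring
  by_cases hs : s = 0
  · subst hs
    exact hasDerivAt_of_hasDerivAt_of_ne (f := fun s => s * radialMean n h s)
      (g := fun s => h s - n * radialMean n h s) key
      (by fun_prop) (by fun_prop)
  · exact key s hs

end RadialMean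

section RadialPotential

variable {α : ℝ} {n : ℕ} {h g : ℝ → ℝ}

lemma continuous_radialFlux (hα : 0 < α) (hh : Continuous h) :
    Continuous fun s => (s * radialMean n h s) ^ α⁻¹ :=
  (continuous_id.mul (continuous_radialMean hh)).rpow_const fun _ => Or.inr (inv_pos.2 hα).le

lemma hasDerivAt_radialPotential (hα : 0 < α) (hh : Continuous h) (r : ℝ) :
    HasDerivAt (radialPotential α n h) (-(r * radialMean n h r) ^ α⁻¹) r := by
  have hc := continuous_radialFlux (n := n) hα hh
  exact intervalIntegral.integral_hasDerivAt_left (hc.intervalIntegrable _ _)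
    (hc.stronglyMeasurableAtFilter _ _) hc.continuousAt

lemma continuous_radialPotential (hα : 0 < α) (hh : Continuous h) :
    Continuous (radialPotential α n h) :=
  continuous_iff_continuousAt.2 fun r => (hasDerivAt_radialPotential hα hh r).continuousAt

@[simp] lemma radialPotential_one : radialPotential α n h 1 = 0 := by
  simp [radialPotential]

lemma Icc_subset_unit {r : ℝ} (hr : r ∈ Icc (0:ℝ) 1) {s : ℝ} (hs : s ∈ Icc r 1) :
    s ∈ Icc (0:ℝ) 1 := ⟨hr.1.trans hs.1, hs.2⟩

lemma radialPotential_congr (hgh : EqOn h g (Icc 0 1)) {r : ℝ} (hr : r ∈ Icc (0:ℝ) 1) :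
    radialPotential α n h r = radialPotential α n g r := by
  unfold radialPotential
  refine intervalIntegral.integral_congr fun s hs => ?_
  rw [uIcc_of_le hr.2] at hs
  simp only [radialMean_congr hgh (Icc_subset_unit hr hs)]

lemma radialFlux_mono (hα : 0 < α) (hh : Continuous h) (hg : Continuous g)
    (hh0 : ∀ t ∈ Icc (0:ℝ) 1, 0 ≤ h t) (hle : ∀ t ∈ Icc (0:ℝ) 1, h t ≤ g t) {s : ℝ}
    (hs : s ∈ Icc (0:ℝ) 1) :
    (s * radialMean n h s) ^ α⁻¹ ≤ (s * radialMean n g s) ^ α⁻¹ :=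
  Real.rpow_le_rpow (mul_nonneg hs.1 (radialMean_nonneg hh0 hs))
    (mul_le_mul_of_nonneg_left (radialMean_mono hh hg hle hs) hs.1) (inv_pos.2 hα).le

lemma radialPotential_mono (hα : 0 < α) (hh : Continuous h) (hg : Continuous g)
    (hh0 : ∀ t ∈ Icc (0:ℝ) 1, 0 ≤ h t) (hle : ∀ t ∈ Icc (0:ℝ) 1, h t ≤ g t) {r : ℝ}
    (hr : r ∈ Icc (0:ℝ) 1) : radialPotential α n h r ≤ radialPotential α n g r :=
  intervalIntegral.integral_mono_on hr.2
    ((continuous_radialFlux hα hh).intervalIntegrable _ _)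
    ((continuous_radialFlux hα hg).intervalIntegrable _ _)
    fun _ hs => radialFlux_mono hα hh hg hh0 hle (Icc_subset_unit hr hs)

lemma radialFlux_nonneg (hh0 : ∀ t ∈ Icc (0:ℝ) 1, 0 ≤ h t) {s : ℝ}
    (hs : s ∈ Icc (0:ℝ) 1) : 0 ≤ (s * radialMean n h s) ^ α⁻¹ :=
  Real.rpow_nonneg (mul_nonneg hs.1 (radialMean_nonneg hh0 hs)) _

lemma radialPotential_nonneg (hh0 : ∀ t ∈ Icc (0:ℝ) 1, 0 ≤ h t) {r : ℝ}
    (hr : r ∈ Icc (0:ℝ) 1) : 0 ≤ radialPotential α n h r :=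
  intervalIntegral.integral_nonneg hr.2 fun _ hs =>
    radialFlux_nonneg hh0 (Icc_subset_unit hr hs)

lemma radialFlux_le (hα : 0 < α) (hh : Continuous h)
    (hh0 : ∀ t ∈ Icc (0:ℝ) 1, 0 ≤ h t) {M : ℝ} (hM0 : 0 ≤ M)
    (hM : ∀ t ∈ Icc (0:ℝ) 1, h t ≤ M) {s : ℝ} (hs : s ∈ Icc (0:ℝ) 1) :
    (s * radialMean n h s) ^ α⁻¹ ≤ M ^ α⁻¹ := by
  have h1 := radialMean_nonneg (n := n) hh0 hs
  exact Real.rpow_le_rpow (mul_nonneg hs.1 h1)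
    ((mul_le_of_le_one_left h1 hs.2).trans (radialMean_le hh hM0 hM hs)) (inv_pos.2 hα).le

lemma radialPotential_sub (hα : 0 < α) (hh : Continuous h) (r t : ℝ) :
    radialPotential α n h r - radialPotential α n h t
      = ∫ s in r..t, (s * radialMean n h s) ^ α⁻¹ := by
  have hc := continuous_radialFlux (n := n) hα hh
  unfold radialPotential
  rw [sub_eq_iff_eq_add, intervalIntegral.integral_add_adjacent_intervals
    (hc.intervalIntegrable _ _) (hc.intervalIntegrable _ _)]

lemma radialPotential_sub_le (hα : 0 < α) (hh : Continuous h)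
    (hh0 : ∀ t ∈ Icc (0:ℝ) 1, 0 ≤ h t) {M : ℝ} (hM0 : 0 ≤ M)
    (hM : ∀ t ∈ Icc (0:ℝ) 1, h t ≤ M) {r t : ℝ} (hr : r ∈ Icc (0:ℝ) 1) (ht : t ∈ Icc (0:ℝ) 1)
    (hrt : r ≤ t) :
    radialPotential α n h r - radialPotential α n h t ≤ M ^ α⁻¹ * (t - r) := by
  rw [radialPotential_sub hα hh]
  have key : ∫ s in r..t, (s * radialMean n h s) ^ α⁻¹ ≤ ∫ _s in r..t, M ^ α⁻¹ :=
    intervalIntegral.integral_mono_on hrt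
      ((continuous_radialFlux hα hh).intervalIntegrable _ _)
      (continuous_const.intervalIntegrable _ _)
      fun s hs => radialFlux_le hα hh hh0 hM0 hM ⟨hr.1.trans hs.1, hs.2.trans ht.2⟩
  rw [intervalIntegral.integral_const, smul_eq_mul] at key
  linarith

lemma radialPotential_anti (hα : 0 < α) (hh : Continuous h)
    (hh0 : ∀ t ∈ Icc (0:ℝ) 1, 0 ≤ h t) {r t : ℝ} (hr : r ∈ Icc (0:ℝ) 1) (ht : t ∈ Icc (0:ℝ) 1)
    (hrt : r ≤ t) : radialPotential α n h t ≤ radialPotential α n h r := by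
  rw [← sub_nonneg, radialPotential_sub hα hh]
  exact intervalIntegral.integral_nonneg hrt fun s hs =>
    radialFlux_nonneg hh0 ⟨hr.1.trans hs.1, hs.2.trans ht.2⟩

lemma exists_upper_bound_unit (hh : Continuous h) :
    ∃ M > 0, ∀ t ∈ Icc (0:ℝ) 1, h t ≤ M := by
  obtain ⟨C, hC⟩ := isCompact_Icc.exists_bound_of_continuousOn (s := Icc (0:ℝ) 1) hh.continuousOn
  exact ⟨max C 1, by positivity, fun t ht =>
    ((le_abs_self _).trans (hC t ht)).trans (le_max_left _ _)⟩

lemma exists_radialPotential_le (hα : 0 < α) (hh : Continuous h)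
    (hh0 : ∀ t ∈ Icc (0:ℝ) 1, 0 ≤ h t) :
    ∃ C > 0, ∀ r ∈ Icc (0:ℝ) 1, radialPotential α n h r ≤ C * (1 - r) := by
  obtain ⟨M, hM0, hM⟩ := exists_upper_bound_unit hh
  refine ⟨M ^ α⁻¹, Real.rpow_pos_of_pos hM0 _, fun r hr => ?_⟩
  simpa using radialPotential_sub_le (n := n) hα hh hh0 hM0.le hM hr
    (right_mem_Icc.2 zero_le_one) hr.2

/-- Strong comparison, including the boundary point `1`. -/
lemma radialPotential_strong_mono (hα : 0 < α) (hh : Continuous h) (hg : Continuous g)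
    (hh0 : ∀ t ∈ Icc (0:ℝ) 1, 0 ≤ h t) (hle : ∀ t ∈ Icc (0:ℝ) 1, h t ≤ g t)
    (hlt : ∃ t ∈ Icc (0:ℝ) 1, h t < g t) :
    ∃ ε > 0, ∀ r ∈ Icc (0:ℝ) 1,
      radialPotential α n h r + ε * (1 - r) ≤ radialPotential α n g r := by
  have h1 : (1:ℝ) ∈ Icc (0:ℝ) 1 := right_mem_Icc.2 zero_le_one
  have hch := continuous_radialFlux (n := n) hα hh
  have hcg := continuous_radialFlux (n := n) hα hg
  set D : ℝ → ℝ := fun s =>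
    (s * radialMean n g s) ^ α⁻¹ - (s * radialMean n h s) ^ α⁻¹ with hD
  have hDc : Continuous D := hcg.sub hch
  have hD0 : ∀ s ∈ Icc (0:ℝ) 1, 0 ≤ D s := fun s hs =>
    sub_nonneg.2 (radialFlux_mono hα hh hg hh0 hle hs)
  have hD1 : 0 < D 1 := by
    rw [hD, sub_pos]
    simp only [one_mul]
    exact Real.rpow_lt_rpow (radialMean_nonneg hh0 h1)
      (radialMean_one_lt hh hg hle hlt) (inv_pos.2 hα)
  have hev : ∀ᶠ s in 𝓝 (1:ℝ), D 1 / 2 < D s :=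
    hDc.continuousAt.eventually (lt_mem_nhds (by linarith))
  obtain ⟨δ, hδ, hball⟩ := Metric.eventually_nhds_iff.1 hev
  set m := min (δ / 2) 1 with hm
  have hm0 : 0 < m := by positivity
  have hm1 : m ≤ 1 := min_le_right _ _
  have hmδ : m ≤ δ / 2 := min_le_left _ _
  refine ⟨D 1 / 2 * m, by positivity, fun r hr => ?_⟩
  have hsub : radialPotential α n g r - radialPotential α n h r = ∫ s in r..1, D s := by
    unfold radialPotential
    rw [← intervalIntegral.integral_sub (hcg.intervalIntegrable _ _) (hch.intervalIntegrable _ _)]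
  set r' := max r (1 - m) with hr'
  have hrr' : r ≤ r' := le_max_left _ _
  have hr'm : 1 - m ≤ r' := le_max_right _ _
  have hr'1 : r' ≤ 1 := max_le hr.2 (by linarith)
  have hsplit : ∫ s in r..1, D s = (∫ s in r..r', D s) + ∫ s in r'..1, D s :=
    (intervalIntegral.integral_add_adjacent_intervals
      (hDc.intervalIntegrable _ _) (hDc.intervalIntegrable _ _)).symm
  have hI1 : 0 ≤ ∫ s in r..r', D s := intervalIntegral.integral_nonneg hrr' fun s hs =>
    hD0 s ⟨hr.1.trans hs.1, hs.2.trans hr'1⟩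
  have hI2 : ∫ _s in r'..1, D 1 / 2 ≤ ∫ s in r'..1, D s :=
    intervalIntegral.integral_mono_on hr'1 (continuous_const.intervalIntegrable _ _)
      (hDc.intervalIntegrable _ _) fun s hs => by
        refine (hball ?_).le
        rw [Real.dist_eq, abs_lt]
        constructor <;> linarith [hs.1, hs.2]
  rw [intervalIntegral.integral_const, smul_eq_mul] at hI2
  have hlen : m * (1 - r) ≤ 1 - r' := by
    rcases max_cases r (1 - m) with ⟨h, _⟩ | ⟨h, _⟩ <;> rw [hr', h]
    · nlinarith [hr.2]
    · nlinarith [hr.1]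
  nlinarith

lemma radialPotential_rpow_mul (hα : 0 < α) (hh0 : ∀ t ∈ Icc (0:ℝ) 1, 0 ≤ h t) {k : ℝ}
    (hk : 0 ≤ k) {r : ℝ} (hr : r ∈ Icc (0:ℝ) 1) :
    radialPotential α n (fun t => k ^ α * h t) r = k * radialPotential α n h r := by
  unfold radialPotential
  rw [← intervalIntegral.integral_const_mul]
  refine intervalIntegral.integral_congr fun s hs => ?_
  rw [uIcc_of_le hr.2] at hs
  have hs' := Icc_subset_unit hr hs
  simp only [radialMean_const_mul]
  rw [mul_left_comm, Real.mul_rpow (Real.rpow_nonneg hk _)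
    (mul_nonneg hs'.1 (radialMean_nonneg hh0 hs')), Real.rpow_rpow_inv hk hα.ne']

end RadialPotential

section Comparison

variable {α : ℝ} {n : ℕ}

lemma radialPotential_pos (hα : 0 < α) {h : ℝ → ℝ} (hh : Continuous h)
    (hh0 : ∀ t ∈ Icc (0:ℝ) 1, 0 ≤ h t) (hpos : ∃ t ∈ Icc (0:ℝ) 1, 0 < h t) {r : ℝ}
    (hr : r ∈ Ico (0:ℝ) 1) : 0 < radialPotential α n h r := by
  obtain ⟨ε, hε, hle⟩ := radialPotential_strong_mono (n := n) hα continuous_const hh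
    (h := fun _ => 0) (fun _ _ => le_rfl) hh0 hpos
  have h0 := radialPotential_nonneg (α := α) (n := n) (h := fun _ => 0) (fun _ _ => le_rfl)
    (Ico_subset_Icc_self hr)
  have := hle r (Ico_subset_Icc_self hr)
  have := mul_pos hε (sub_pos.2 hr.2)
  linarith

lemma continuous_weight_mul_rpow (hα : 0 < α) {W u : ℝ → ℝ} (hW : Continuous W)
    (hu : Continuous u) : Continuous fun t => W t * u t ^ α :=
  hW.mul (hu.rpow_const fun _ => Or.inr hα.le)

/-- If `u ≤ c⁻¹ v` then the potential of `W v^α` beats `c` times the potential of `W u^α` by a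
definite proportion, as soon as the inequality between the densities is somewhere strict. -/
lemma exists_gain (hα : 0 < α) {W₁ W₂ u v : ℝ → ℝ} (hW₁ : Continuous W₁) (hW₂ : Continuous W₂)
    (hW₂0 : ∀ t ∈ Icc (0:ℝ) 1, 0 ≤ W₂ t) (hW : ∀ t ∈ Icc (0:ℝ) 1, W₂ t ≤ W₁ t)
    (hu : Continuous u) (hv : Continuous v) (hu0 : ∀ t ∈ Icc (0:ℝ) 1, 0 ≤ u t)
    {c : ℝ} (hc : 0 ≤ c) (huv : ∀ t ∈ Icc (0:ℝ) 1, c * u t ≤ v t)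
    (hlt : ∃ t ∈ Icc (0:ℝ) 1, W₂ t * (c * u t) ^ α < W₁ t * v t ^ α) :
    ∃ δ > 0, ∀ r ∈ Icc (0:ℝ) 1,
      (c + δ) * radialPotential α n (fun t => W₂ t * u t ^ α) r ≤
        radialPotential α n (fun t => W₁ t * v t ^ α) r := by
  have hcu := continuous_weight_mul_rpow hα hW₂ hu
  have hcv := continuous_weight_mul_rpow hα hW₁ hv
  have hu0' : ∀ t ∈ Icc (0:ℝ) 1, 0 ≤ W₂ t * u t ^ α := fun t ht =>
    mul_nonneg (hW₂0 t ht) (Real.rpow_nonneg (hu0 t ht) _)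
  have heq : ∀ t ∈ Icc (0:ℝ) 1, c ^ α * (W₂ t * u t ^ α) = W₂ t * (c * u t) ^ α := fun t ht => by
    rw [Real.mul_rpow hc (hu0 t ht)]
    ring
  obtain ⟨ε, hε, hgain⟩ := radialPotential_strong_mono (n := n) hα
    (h := fun t => c ^ α * (W₂ t * u t ^ α)) (continuous_const.mul hcu) hcv
    (fun t ht => mul_nonneg (Real.rpow_nonneg hc _) (hu0' t ht))
    (fun t ht => by
      rw [heq t ht]
      exact mul_le_mul (hW t ht)
        (Real.rpow_le_rpow (mul_nonneg hc (hu0 t ht)) (huv t ht) hα.le)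
        (Real.rpow_nonneg (mul_nonneg hc (hu0 t ht)) _) ((hW₂0 t ht).trans (hW t ht)))
    (by
      obtain ⟨t, ht, hlt⟩ := hlt
      exact ⟨t, ht, by rwa [heq t ht]⟩)
  obtain ⟨C, hC, hle⟩ := exists_radialPotential_le (n := n) hα hcu hu0'
  refine ⟨ε / C, div_pos hε hC, fun r hr => ?_⟩
  have h1 := hgain r hr
  rw [radialPotential_rpow_mul hα hu0' hc hr] at h1
  have h2 : ε / C * radialPotential α n (fun t => W₂ t * u t ^ α) r ≤ ε * (1 - r) := by
    calc ε / C * radialPotential α n (fun t => W₂ t * u t ^ α) r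
        ≤ ε / C * (C * (1 - r)) := mul_le_mul_of_nonneg_left (hle r hr) (div_pos hε hC).le
      _ = ε * (1 - r) := by field_simp
  linarith

lemma nonneg_of_pos_of_zero {v : ℝ → ℝ} (hpos : ∀ r ∈ Ico (0:ℝ) 1, 0 < v r) (hv1 : v 1 = 0) :
    ∀ r ∈ Icc (0:ℝ) 1, 0 ≤ v r := fun r hr => by
  rcases hr.2.eq_or_lt with rfl | hlt
  · exact hv1.ge
  · exact (hpos r ⟨hr.1, hlt⟩).le

/-- Two ordered weights which both admit a positive fixed point coincide. -/
lemma weight_eqOn_of_le (hα : 0 < α) {W₁ W₂ v₁ v₂ : ℝ → ℝ} (hW₁ : Continuous W₁)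
    (hW₂ : Continuous W₂) (hW₂0 : ∀ t ∈ Icc (0:ℝ) 1, 0 ≤ W₂ t)
    (hW : ∀ t ∈ Icc (0:ℝ) 1, W₂ t ≤ W₁ t) (hv₁ : Continuous v₁) (hv₂ : Continuous v₂)
    (hpos₁ : ∀ r ∈ Ico (0:ℝ) 1, 0 < v₁ r) (hpos₂ : ∀ r ∈ Ico (0:ℝ) 1, 0 < v₂ r)
    (hfix₁ : ∀ r ∈ Icc (0:ℝ) 1, v₁ r = radialPotential α n (fun t => W₁ t * v₁ t ^ α) r)
    (hfix₂ : ∀ r ∈ Icc (0:ℝ) 1, v₂ r = radialPotential α n (fun t => W₂ t * v₂ t ^ α) r) :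
    EqOn W₂ W₁ (Ioo 0 1) := by
  have h1 : (1:ℝ) ∈ Icc (0:ℝ) 1 := right_mem_Icc.2 zero_le_one
  have h0 : (0:ℝ) ∈ Ico (0:ℝ) 1 := left_mem_Ico.2 zero_lt_one
  have hnn₁ := nonneg_of_pos_of_zero hpos₁ (by rw [hfix₁ 1 h1, radialPotential_one])
  have hnn₂ := nonneg_of_pos_of_zero hpos₂ (by rw [hfix₂ 1 h1, radialPotential_one])
  set K : Set ℝ := {k | 0 ≤ k ∧ ∀ r ∈ Icc (0:ℝ) 1, k * v₂ r ≤ v₁ r} with hK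
  have hKne : K.Nonempty := ⟨0, le_rfl, fun r hr => by simpa using hnn₁ r hr⟩
  have hKbdd : BddAbove K := ⟨v₁ 0 / v₂ 0, fun k hk =>
    (le_div_iff₀ (hpos₂ 0 h0)).2 (hk.2 0 (Ico_subset_Icc_self h0))⟩
  have hKcl : IsClosed K := by
    simp only [hK, ofPred_and, ofPred_forall]
    refine isClosed_Ici.inter (isClosed_iInter fun r => isClosed_iInter fun _ => ?_)
    exact isClosed_le (by fun_prop) (by fun_prop)
  obtain ⟨hk0, hk⟩ := hKcl.csSup_mem hKne hKbdd
  intro t ht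
  by_contra hne
  have ht' := Ioo_subset_Icc_self ht
  have hlt : W₂ t < W₁ t := lt_of_le_of_ne (hW t ht') hne
  have hv₁t := hpos₁ t (Ioo_subset_Ico_self ht)
  obtain ⟨δ, hδ, hgain⟩ := exists_gain (n := n) hα hW₁ hW₂ hW₂0 hW hv₂ hv₁ hnn₂ hk0 hk ⟨t, ht', by
    calc W₂ t * (sSup K * v₂ t) ^ α ≤ W₂ t * v₁ t ^ α :=
          mul_le_mul_of_nonneg_left (Real.rpow_le_rpow (mul_nonneg hk0 (hnn₂ t ht'))
            (hk t ht') hα.le) (hW₂0 t ht')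
      _ < W₁ t * v₁ t ^ α := mul_lt_mul_of_pos_right hlt (Real.rpow_pos_of_pos hv₁t _)⟩
  have hmem : sSup K + δ ∈ K := ⟨by positivity, fun r hr => by
    rw [hfix₁ r hr, hfix₂ r hr]
    exact hgain r hr⟩
  linarith [le_csSup hKbdd hmem]

end Comparison

section Existence

open scoped BoundedContinuousFunction

variable {α : ℝ} {n : ℕ}

/-- Extension of a function on `[0,1]` by its boundary values. -/
def clampExtend (f : Icc (0:ℝ) 1 →ᵇ ℝ) (t : ℝ) : ℝ := f (projIcc 0 1 zero_le_one t)

lemma continuous_uncurry_clampExtend :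
    Continuous fun x : (Icc (0:ℝ) 1 →ᵇ ℝ) × ℝ => clampExtend x.1 x.2 := by
  unfold clampExtend
  have h : Continuous (projIcc (0:ℝ) 1 zero_le_one) := continuous_projIcc
  fun_prop

lemma continuous_clampExtend (f : Icc (0:ℝ) 1 →ᵇ ℝ) : Continuous (clampExtend f) :=
  continuous_uncurry_clampExtend.comp (Continuous.prodMk_right f)

lemma continuous_clampExtend_apply (t : ℝ) :
    Continuous fun f : Icc (0:ℝ) 1 →ᵇ ℝ => clampExtend f t :=
  continuous_uncurry_clampExtend.comp (Continuous.prodMk_left t)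

lemma continuous_radialPotential_clampExtend (hα : 0 < α) {W : ℝ → ℝ} (hW : Continuous W)
    (r : ℝ) : Continuous fun f : Icc (0:ℝ) 1 →ᵇ ℝ =>
      radialPotential α n (fun t => W t * clampExtend f t ^ α) r := by
  have h1 : Continuous fun x : (Icc (0:ℝ) 1 →ᵇ ℝ) × ℝ =>
      radialMean n (fun t => W t * clampExtend x.1 t ^ α) x.2 := by
    unfold radialMean
    apply continuous_parametric_intervalIntegral_of_continuous'
    have h2 : Continuous fun y : ((Icc (0:ℝ) 1 →ᵇ ℝ) × ℝ) × ℝ =>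
        clampExtend y.1.1 (y.1.2 * y.2) ^ α :=
      Continuous.rpow_const (continuous_uncurry_clampExtend.comp
        (g := fun x : (Icc (0:ℝ) 1 →ᵇ ℝ) × ℝ => clampExtend x.1 x.2)
        (f := fun y : ((Icc (0:ℝ) 1 →ᵇ ℝ) × ℝ) × ℝ => (y.1.1, y.1.2 * y.2)) (by fun_prop))
        fun _ => Or.inr hα.le
    unfold Function.uncurry
    fun_prop
  unfold radialPotential
  apply continuous_parametric_intervalIntegral_of_continuous'
  exact (continuous_snd.mul h1).rpow_const fun _ => Or.inr (inv_pos.2 hα).le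

/-- Pairs `(c, f)` with `c ∈ [c₀, C]`, `f` normalized and `K`-Lipschitz, and `c f` below the
potential of `W f^α`. -/
def subsolutionSet (α : ℝ) (n : ℕ) (W : ℝ → ℝ) (c₀ C K : ℝ) : Set (ℝ × (Icc (0:ℝ) 1 →ᵇ ℝ)) :=
  {x | x.1 ∈ Icc c₀ C ∧ ((∀ t, x.2 t ∈ Icc (0:ℝ) 1) ∧
      ∀ s t, |x.2 s - x.2 t| ≤ K * |(s:ℝ) - t|) ∧ clampExtend x.2 0 = 1 ∧
      ∀ r ∈ Icc (0:ℝ) 1, x.1 * clampExtend x.2 r ≤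
        radialPotential α n (fun t => W t * clampExtend x.2 t ^ α) r}

lemma isCompact_lipschitz_unit {K : ℝ} (hK : 0 ≤ K) :
    IsCompact {f : Icc (0:ℝ) 1 →ᵇ ℝ | (∀ t, f t ∈ Icc (0:ℝ) 1) ∧
      ∀ s t, |f s - f t| ≤ K * |(s:ℝ) - t|} := by
  have hev : ∀ t, Continuous fun f : Icc (0:ℝ) 1 →ᵇ ℝ => f t := fun t => by fun_prop
  refine BoundedContinuousFunction.arzela_ascoli₂ (Icc (0:ℝ) 1) isCompact_Icc _ ?_
    (fun f t hf => hf.1 t) ?_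
  · simp only [ofPred_and, ofPred_forall]
    refine (isClosed_iInter fun t => isClosed_Icc.preimage (hev t)).inter
      (isClosed_iInter fun s => isClosed_iInter fun t => ?_)
    exact isClosed_le ((hev s).sub (hev t)).abs continuous_const
  · refine (LipschitzWith.uniformEquicontinuous _ ⟨K, hK⟩ fun f => ?_).equicontinuous
    exact LipschitzWith.of_dist_le_mul fun s t => f.2.2 s t

lemma isCompact_subsolutionSet (hα : 0 < α) {W : ℝ → ℝ} (hW : Continuous W) (c₀ C : ℝ) {K : ℝ}
    (hK : 0 ≤ K) : IsCompact (subsolutionSet α n W c₀ C K) := by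
  have hcl : IsClosed {x : ℝ × (Icc (0:ℝ) 1 →ᵇ ℝ) | clampExtend x.2 0 = 1 ∧
      ∀ r ∈ Icc (0:ℝ) 1, x.1 * clampExtend x.2 r ≤
        radialPotential α n (fun t => W t * clampExtend x.2 t ^ α) r} := by
    simp only [ofPred_and, ofPred_forall]
    have hev : ∀ t, Continuous fun x : ℝ × (Icc (0:ℝ) 1 →ᵇ ℝ) => clampExtend x.2 t :=
      fun t => (continuous_clampExtend_apply t).comp continuous_snd
    refine (isClosed_eq (hev 0) continuous_const).inter
      (isClosed_iInter fun r => isClosed_iInter fun _ => ?_)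
    exact isClosed_le (continuous_fst.mul (hev r))
      ((continuous_radialPotential_clampExtend hα hW r).comp continuous_snd)
  convert (((isCompact_Icc (a := c₀) (b := C)).prod (isCompact_lipschitz_unit hK)).inter_right
    hcl) using 1
  ext x
  simp only [subsolutionSet, mem_ofPred_eq, mem_inter_iff, mem_prod, and_assoc]

/-- The normalized potential of a subsolution lies in `subsolutionSet`. -/
lemma exists_mem_subsolutionSet (hα : 0 < α) {W u : ℝ → ℝ} (hW : Continuous W)
    (hW0 : ∀ t ∈ Icc (0:ℝ) 1, 0 ≤ W t) {M : ℝ} (hM0 : 0 ≤ M) (hM : ∀ t ∈ Icc (0:ℝ) 1, W t ≤ M)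
    (hu : Continuous u) (hu01 : ∀ t ∈ Icc (0:ℝ) 1, u t ∈ Icc (0:ℝ) 1) {c₀ c : ℝ} (hc₀ : 0 < c₀)
    (hc : c₀ ≤ c) {v : ℝ → ℝ} (hv : v = radialPotential α n (fun t => W t * u t ^ α))
    (hv0 : c₀ ≤ v 0)
    (hsub : ∀ r ∈ Icc (0:ℝ) 1, c * v r ≤ radialPotential α n (fun t => W t * v t ^ α) r) :
    ∃ f, (c, f) ∈ subsolutionSet α n W c₀ (M ^ α⁻¹) (M ^ α⁻¹ / c₀) := by
  have h0 : (0:ℝ) ∈ Icc (0:ℝ) 1 := left_mem_Icc.2 zero_le_one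
  have h1 : (1:ℝ) ∈ Icc (0:ℝ) 1 := right_mem_Icc.2 zero_le_one
  have bounds : ∀ {z : ℝ → ℝ}, (∀ t ∈ Icc (0:ℝ) 1, z t ∈ Icc (0:ℝ) 1) →
      ∀ t ∈ Icc (0:ℝ) 1, W t * z t ^ α ∈ Icc 0 M := fun hz t ht =>
    have hz' := hz t ht
    ⟨mul_nonneg (hW0 t ht) (Real.rpow_nonneg hz'.1 _), by
      calc W t * _ ^ α ≤ M * 1 := mul_le_mul (hM t ht) (Real.rpow_le_one hz'.1 hz'.2 hα.le)
            (Real.rpow_nonneg hz'.1 _) hM0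
        _ = M := mul_one M⟩
  have hcu := continuous_weight_mul_rpow hα hW hu
  have hvc : Continuous v := hv ▸ continuous_radialPotential hα hcu
  have hv0' : 0 < v 0 := hc₀.trans_le hv0
  have hvnn : ∀ t ∈ Icc (0:ℝ) 1, 0 ≤ v t := fun t ht => by
    rw [hv]
    exact radialPotential_nonneg (fun t ht => (bounds hu01 t ht).1) ht
  have hvanti : ∀ s ∈ Icc (0:ℝ) 1, ∀ t ∈ Icc (0:ℝ) 1, s ≤ t → v t ≤ v s := fun s hs t ht hst => by
    rw [hv]
    exact radialPotential_anti hα hcu (fun t ht => (bounds hu01 t ht).1) hs ht hst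
  have hvlip : ∀ s ∈ Icc (0:ℝ) 1, ∀ t ∈ Icc (0:ℝ) 1, s ≤ t →
      v s - v t ≤ M ^ α⁻¹ * (t - s) := fun s hs t ht hst => by
    rw [hv]
    exact radialPotential_sub_le hα hcu (fun t ht => (bounds hu01 t ht).1) hM0
      (fun t ht => (bounds hu01 t ht).2) hs ht hst
  have hMα : 0 ≤ M ^ α⁻¹ := Real.rpow_nonneg hM0 _
  have hvlip' : ∀ s ∈ Icc (0:ℝ) 1, ∀ t ∈ Icc (0:ℝ) 1,
      |v s - v t| ≤ M ^ α⁻¹ * |s - t| := fun s hs t ht => by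
    rcases le_total s t with hst | hst
    · rw [abs_of_nonneg (sub_nonneg.2 (hvanti s hs t ht hst)), abs_sub_comm s t,
        abs_of_nonneg (sub_nonneg.2 hst)]
      exact hvlip s hs t ht hst
    · rw [abs_sub_comm (v s), abs_of_nonneg (sub_nonneg.2 (hvanti t ht s hs hst)),
        abs_of_nonneg (sub_nonneg.2 hst)]
      exact hvlip t ht s hs hst
  let f : Icc (0:ℝ) 1 →ᵇ ℝ := BoundedContinuousFunction.mkOfCompact
    ⟨fun t => (v 0)⁻¹ * v t, by fun_prop⟩
  have hf : ∀ t, f t = (v 0)⁻¹ * v t := fun t => rfl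
  have hfE : ∀ t ∈ Icc (0:ℝ) 1, clampExtend f t = (v 0)⁻¹ * v t := fun t ht => by
    rw [clampExtend, projIcc_of_mem _ ht, hf]
  have hinv : 0 ≤ (v 0)⁻¹ := (inv_pos.2 hv0').le
  have hf01 : ∀ t, f t ∈ Icc (0:ℝ) 1 := fun t =>
    ⟨mul_nonneg hinv (hvnn t t.2), by
      rw [hf, inv_mul_le_one₀ hv0']
      exact hvanti 0 h0 t t.2 t.2.1⟩
  have hf0 : clampExtend f 0 = 1 := by rw [hfE 0 h0, inv_mul_cancel₀ hv0'.ne']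
  have hfsub : ∀ r ∈ Icc (0:ℝ) 1, c * clampExtend f r ≤
      radialPotential α n (fun t => W t * clampExtend f t ^ α) r := fun r hr => by
    have hcongr : EqOn (fun t => W t * clampExtend f t ^ α)
        (fun t => (v 0)⁻¹ ^ α * (W t * v t ^ α)) (Icc 0 1) := fun t ht => by
      simp only [hfE t ht]
      rw [Real.mul_rpow hinv (hvnn t ht)]
      ring
    rw [radialPotential_congr hcongr hr, radialPotential_rpow_mul hα
      (fun t ht => mul_nonneg (hW0 t ht) (Real.rpow_nonneg (hvnn t ht) _)) hinv hr, hfE r hr,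
      mul_left_comm]
    exact mul_le_mul_of_nonneg_left (hsub r hr) hinv
  refine ⟨f, ⟨hc, ?_⟩, ⟨hf01, fun s t => ?_⟩, hf0, hfsub⟩
  · have hE01 : ∀ t ∈ Icc (0:ℝ) 1, clampExtend f t ∈ Icc (0:ℝ) 1 := fun t _ => hf01 _
    have h2 := radialPotential_sub_le (n := n) hα
      (continuous_weight_mul_rpow hα hW (continuous_clampExtend f))
      (fun t ht => (bounds hE01 t ht).1) hM0 (fun t ht => (bounds hE01 t ht).2) h0 h1 zero_le_one
    have h3 := hfsub 0 h0
    rw [hf0] at h3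
    simp only [radialPotential_one] at h2
    linarith
  · rw [hf, hf, ← mul_sub, abs_mul, abs_of_nonneg hinv]
    calc (v 0)⁻¹ * |v s - v t| ≤ c₀⁻¹ * (M ^ α⁻¹ * |(s:ℝ) - t|) :=
          mul_le_mul (inv_anti₀ hc₀ hv0) (hvlip' s s.2 t t.2) (abs_nonneg _) (inv_pos.2 hc₀).le
      _ = M ^ α⁻¹ / c₀ * |(s:ℝ) - t| := by ring

lemma exists_initial_subsolution (hα : 0 < α) {W : ℝ → ℝ} (hW : Continuous W)
    (hW0 : ∀ t ∈ Icc (0:ℝ) 1, 0 < W t) :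
    ∃ u : ℝ → ℝ, ∃ c > 0, Continuous u ∧ (∀ t ∈ Icc (0:ℝ) 1, u t ∈ Icc (0:ℝ) 1) ∧ u 0 = 1 ∧
      ∀ r ∈ Icc (0:ℝ) 1, c * u r ≤ radialPotential α n (fun t => W t * u t ^ α) r := by
  let u : ℝ → ℝ := fun t => max 0 (1 - 2 * t)
  have hu : Continuous u := by fun_prop
  have hu01 : ∀ t ∈ Icc (0:ℝ) 1, u t ∈ Icc (0:ℝ) 1 := fun t ht =>
    ⟨le_max_left _ _, max_le zero_le_one (by linarith [ht.1])⟩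
  have hu0 : u 0 = 1 := by simp [u]
  have hcu := continuous_weight_mul_rpow hα hW hu
  have hnn : ∀ t ∈ Icc (0:ℝ) 1, 0 ≤ W t * u t ^ α := fun t ht =>
    mul_nonneg (hW0 t ht).le (Real.rpow_nonneg (hu01 t ht).1 _)
  have h0 : (0:ℝ) ∈ Icc (0:ℝ) 1 := left_mem_Icc.2 zero_le_one
  have hhalf : (1/2:ℝ) ∈ Ico (0:ℝ) 1 := by constructor <;> norm_num
  have hpos := radialPotential_pos (n := n) hα hcu hnn
    ⟨0, h0, by rw [hu0, Real.one_rpow, mul_one]; exact hW0 0 h0⟩ hhalf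
  refine ⟨u, _, hpos, hu, hu01, hu0, fun r hr => ?_⟩
  rcases le_total r (1/2) with h | h
  · exact (mul_le_of_le_one_right hpos.le (hu01 r hr).2).trans
      (radialPotential_anti hα hcu hnn hr (Ico_subset_Icc_self hhalf) h)
  · have : u r = 0 := max_eq_left (by linarith)
    rw [this, mul_zero]
    exact radialPotential_nonneg hnn hr

/-- Existence of a positive eigenfunction of the operator `u ↦ radialPotential α n (W u^α)`. -/
lemma exists_eigenfunction (hα : 0 < α) {W : ℝ → ℝ} (hW : Continuous W)
    (hW0 : ∀ t ∈ Icc (0:ℝ) 1, 0 < W t) :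
    ∃ u : ℝ → ℝ, ∃ a > 0, Continuous u ∧ (∀ t ∈ Icc (0:ℝ) 1, 0 ≤ u t) ∧ u 0 = 1 ∧
      ∀ r ∈ Icc (0:ℝ) 1, a * u r = radialPotential α n (fun t => W t * u t ^ α) r := by
  have h0 : (0:ℝ) ∈ Icc (0:ℝ) 1 := left_mem_Icc.2 zero_le_one
  have hWnn : ∀ t ∈ Icc (0:ℝ) 1, 0 ≤ W t := fun t ht => (hW0 t ht).le
  obtain ⟨M, hM0, hM⟩ := exists_upper_bound_unit hW
  obtain ⟨u₀, c₀, hc₀, hu₀, hu₀01, hu₀0, hu₀sub⟩ := exists_initial_subsolution (n := n) hα hW hW0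
  have hK : 0 ≤ M ^ α⁻¹ / c₀ := div_nonneg (Real.rpow_nonneg hM0.le _) hc₀.le
  have hmono : ∀ {u : ℝ → ℝ} {c : ℝ}, 0 ≤ c → Continuous u → (∀ t ∈ Icc (0:ℝ) 1, 0 ≤ u t) →
      ∀ {v : ℝ → ℝ}, v = radialPotential α n (fun t => W t * u t ^ α) →
      (∀ r ∈ Icc (0:ℝ) 1, c * u r ≤ v r) →
      ∀ r ∈ Icc (0:ℝ) 1, c * v r ≤ radialPotential α n (fun t => W t * v t ^ α) r := by
    intro u c hc hu hunn v hv hle r hr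
    have hcu := continuous_weight_mul_rpow hα hW hu
    have hvc : Continuous v := hv ▸ continuous_radialPotential hα hcu
    have hnn : ∀ t ∈ Icc (0:ℝ) 1, 0 ≤ W t * u t ^ α := fun t ht =>
      mul_nonneg (hWnn t ht) (Real.rpow_nonneg (hunn t ht) _)
    have hvr : v r = _ := congrFun hv r
    rw [hvr, ← radialPotential_rpow_mul hα hnn hc hr]
    refine radialPotential_mono hα (continuous_const.mul hcu)
      (continuous_weight_mul_rpow hα hW hvc)
      (fun t ht => mul_nonneg (Real.rpow_nonneg hc _) (hnn t ht)) (fun t ht => ?_) hr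
    change c ^ α * (W t * u t ^ α) ≤ W t * v t ^ α
    rw [mul_left_comm, ← Real.mul_rpow hc (hunn t ht)]
    exact mul_le_mul_of_nonneg_left
      (Real.rpow_le_rpow (mul_nonneg hc (hunn t ht)) (hle t ht) hα.le) (hWnn t ht)
  have hne : (subsolutionSet α n W c₀ (M ^ α⁻¹) (M ^ α⁻¹ / c₀)).Nonempty := by
    obtain ⟨f, hf⟩ := exists_mem_subsolutionSet (n := n) hα hW hWnn hM0.le hM hu₀ hu₀01 hc₀ le_rfl
      rfl (by simpa [hu₀0] using hu₀sub 0 h0)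
      (hmono hc₀.le hu₀ (fun t ht => (hu₀01 t ht).1) rfl hu₀sub)
    exact ⟨_, hf⟩
  obtain ⟨⟨a, f⟩, ⟨hac, ⟨hf01, _⟩, hf0, hfsub⟩, hmax⟩ :=
    (isCompact_subsolutionSet (n := n) hα hW c₀ (M ^ α⁻¹) hK).exists_isMaxOn hne
      (continuous_fst.continuousOn)
  simp only at hac hf01 hf0 hfsub
  have ha : 0 < a := hc₀.trans_le hac.1
  have hu01 : ∀ t ∈ Icc (0:ℝ) 1, clampExtend f t ∈ Icc (0:ℝ) 1 := fun t _ => hf01 _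
  have hunn : ∀ t ∈ Icc (0:ℝ) 1, 0 ≤ clampExtend f t := fun t ht => (hu01 t ht).1
  have huc := continuous_clampExtend f
  refine ⟨clampExtend f, a, ha, huc, hunn, hf0, fun r hr => ?_⟩
  by_contra hne
  set v := radialPotential α n (fun t => W t * clampExtend f t ^ α) with hv
  have hvc : Continuous v := continuous_radialPotential hα (continuous_weight_mul_rpow hα hW huc)
  have hlt := lt_of_le_of_ne (hfsub r hr) hne
  obtain ⟨δ, hδ, hgain⟩ := exists_gain (n := n) hα hW hW hWnn (fun _ _ => le_rfl) huc hvc hunn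
    ha.le hfsub ⟨r, hr, mul_lt_mul_of_pos_left
      (Real.rpow_lt_rpow (mul_nonneg ha.le (hunn r hr)) hlt hα) (hW0 r hr)⟩
  obtain ⟨g, hg⟩ := exists_mem_subsolutionSet (n := n) (c := a + δ) hα hW hWnn hM0.le hM huc hu01
    hc₀ (by linarith [hac.1]) hv
    (by
      have := hfsub 0 h0
      rw [hf0, mul_one] at this
      exact hac.1.trans this) hgain
  have : a + δ ≤ a := hmax hg
  linarith

end Existence

section Eigenpair

lemma phi_of_nonneg {p x : ℝ} (hp : 1 < p) (hx : 0 ≤ x) : phi p x = x ^ (p - 1) := by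
  rcases hx.eq_or_lt with rfl | hx
  · simp [phi, Real.zero_rpow (sub_pos.2 hp).ne']
  · rw [phi, abs_of_pos hx, ← Real.rpow_add_one hx.ne']
    congr 1
    ring

lemma phi_neg (p x : ℝ) : phi p (-x) = -phi p x := by
  simp [phi]

lemma phi_neg_rpow_inv {p y : ℝ} (hp : 1 < p) (hy : 0 ≤ y) :
    phi p (-y ^ (p - 1)⁻¹) = -y := by
  rw [phi_neg, phi_of_nonneg hp (Real.rpow_nonneg hy _), Real.rpow_inv_rpow hy (sub_pos.2 hp).ne']

lemma nonneg_of_phi_nonneg {p x : ℝ} (h : 0 ≤ phi p x) : 0 ≤ x := by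
  by_contra! hx
  have : 0 < |x| ^ (p - 2) := Real.rpow_pos_of_pos (abs_pos.2 hx.ne) _
  exact absurd (mul_neg_of_pos_of_neg this hx) h.not_gt

lemma eq_neg_rpow_inv_of_phi_eq {p x y : ℝ} (hp : 1 < p) (hy : 0 ≤ y) (h : phi p x = -y) :
    x = -y ^ (p - 1)⁻¹ := by
  have h1 : phi p (-x) = y := by rw [phi_neg, h, neg_neg]
  have hx : 0 ≤ -x := nonneg_of_phi_nonneg (h1.symm ▸ hy)
  rw [phi_of_nonneg hp hx] at h1
  rw [← h1, Real.rpow_rpow_inv hx (sub_pos.2 hp).ne', neg_neg]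

lemma exists_continuous_eqOn_unit {w : ℝ → ℝ} (hw : ContinuousOn w (Icc 0 1)) :
    ∃ W : ℝ → ℝ, Continuous W ∧ EqOn W w (Icc 0 1) :=
  ⟨fun t => w (projIcc 0 1 zero_le_one t),
    hw.comp_continuous (continuous_subtype_val.comp (continuous_projIcc (h := zero_le_one))) fun t => Subtype.prop _,
    fun t ht => by simp only [projIcc_of_mem _ ht]⟩

lemma c1on01_of_hasDerivWithinAt {f f' : ℝ → ℝ}
    (hf : ∀ r ∈ Icc (0:ℝ) 1, HasDerivWithinAt f (f' r) (Icc 0 1) r)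
    (hf' : ContinuousOn f' (Icc 0 1)) : C1on01 f ∧ EqOn (deriv01 f) f' (Icc 0 1) := by
  have heq : EqOn (deriv01 f) f' (Icc 0 1) := fun r hr =>
    (hf r hr).derivWithin (uniqueDiffOn_Icc zero_lt_one r hr)
  exact ⟨⟨fun r hr => (hf r hr).differentiableWithinAt, hf'.congr heq⟩, heq⟩

lemma C1on01.continuousOn {f : ℝ → ℝ} (hf : C1on01 f) : ContinuousOn f (Icc 0 1) :=
  fun r hr => (hf.1 r hr).continuousWithinAt

lemma C1on01.hasDerivAt {f : ℝ → ℝ} (hf : C1on01 f) {r : ℝ} (hr : r ∈ Ioo (0:ℝ) 1) :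
    HasDerivAt f (deriv01 f r) r :=
  (hf.1 r (Ioo_subset_Icc_self hr)).hasDerivWithinAt.hasDerivAt (Icc_mem_nhds hr.1 hr.2)

variable {p : ℝ} {N : ℕ} {w v W V : ℝ → ℝ} {μ : ℝ}

/-- The once-integrated equation. -/
lemma phi_deriv01_eq (hp : 1 < p) (hphi : C1on01 fun r => phi p (deriv01 v r))
    (hpos : ∀ r ∈ Ico (0:ℝ) 1, 0 < v r)
    (heq : ∀ r ∈ Ioo (0:ℝ) 1, HasDerivAt (fun s => s ^ (N - 1) * phi p (deriv01 v s))
      (-(μ * r ^ (N - 1) * w r * phi p (v r))) r)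
    (hv0 : deriv01 v 0 = 0) (hWc : Continuous W) (hW : EqOn W w (Icc 0 1)) (hVc : Continuous V)
    (hV : EqOn V v (Icc 0 1)) {r : ℝ} (hr : r ∈ Icc (0:ℝ) 1) :
    phi p (deriv01 v r) =
      -(μ * (r * radialMean (N - 1) (fun t => W t * V t ^ (p - 1)) r)) := by
  have hphi0 : phi p (deriv01 v 0) = 0 := by rw [hv0]; simp [phi]
  rcases hr.1.eq_or_lt with rfl | hr0
  · simp [hphi0]
  have hg := continuous_weight_mul_rpow (sub_pos.2 hp) hWc hVc
  have hsub : Icc 0 r ⊆ Icc (0:ℝ) 1 := Icc_subset_Icc_right hr.2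
  have hFTC := intervalIntegral.integral_eq_sub_of_hasDerivAt_of_le hr.1
    (f := fun s => s ^ (N - 1) * phi p (deriv01 v s))
    (f' := fun t => (-μ) * (t ^ (N - 1) * (W t * V t ^ (p - 1))))
    ((ContinuousOn.mul (by fun_prop) hphi.continuousOn).mono hsub)
    (fun t ht => by
      have ht' : t ∈ Ioo (0:ℝ) 1 := ⟨ht.1, ht.2.trans_le hr.2⟩
      have ht1 := Ioo_subset_Icc_self ht'
      have hval : -μ * (t ^ (N - 1) * (W t * V t ^ (p - 1))) =
          -(μ * t ^ (N - 1) * w t * phi p (v t)) := by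
        rw [hW ht1, hV ht1, phi_of_nonneg hp (hpos t (Ioo_subset_Ico_self ht')).le]
        ring
      rw [hval]
      exact heq t ht')
    (Continuous.intervalIntegrable (by fun_prop) _ _)
  rw [intervalIntegral.integral_const_mul, ← pow_mul_mul_radialMean] at hFTC
  simp only [hphi0, mul_zero, sub_zero] at hFTC
  apply mul_left_cancel₀ (pow_ne_zero (N - 1) hr0.ne')
  rw [← hFTC]
  ring

lemma density_nonneg (hw : ∀ r ∈ Icc (0:ℝ) 1, 0 < w r) (hpos : ∀ r ∈ Icc (0:ℝ) 1, 0 ≤ v r)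
    (hW : EqOn W w (Icc 0 1)) (hV : EqOn V v (Icc 0 1)) {α : ℝ} :
    ∀ t ∈ Icc (0:ℝ) 1, 0 ≤ W t * V t ^ α := fun t ht => by
  rw [hW ht, hV ht]
  exact mul_nonneg (hw t ht).le (Real.rpow_nonneg (hpos t ht) _)

/-- A positive solution of the eigenvalue problem can only exist for a positive parameter. -/
lemma eigenvalue_pos (hp : 1 < p) (hwc : ContinuousOn w (Icc 0 1))
    (hw : ∀ r ∈ Icc (0:ℝ) 1, 0 < w r) (hv : C1on01 v)
    (hphi : C1on01 fun r => phi p (deriv01 v r)) (hpos : ∀ r ∈ Ico (0:ℝ) 1, 0 < v r)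
    (heq : ∀ r ∈ Ioo (0:ℝ) 1, HasDerivAt (fun s => s ^ (N - 1) * phi p (deriv01 v s))
      (-(μ * r ^ (N - 1) * w r * phi p (v r))) r)
    (hv0 : deriv01 v 0 = 0) (hv1 : v 1 = 0) : 0 < μ := by
  obtain ⟨W, hWc, hW⟩ := exists_continuous_eqOn_unit hwc
  obtain ⟨V, hVc, hV⟩ := exists_continuous_eqOn_unit hv.continuousOn
  by_contra! hμ
  have hmono : MonotoneOn v (Icc 0 1) := by
    refine monotoneOn_of_deriv_nonneg (convex_Icc 0 1) hv.continuousOn ?_ ?_ <;>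
      rw [interior_Icc] <;> intro r hr
    · exact (hv.hasDerivAt hr).differentiableAt.differentiableWithinAt
    · rw [(hv.hasDerivAt hr).deriv]
      apply nonneg_of_phi_nonneg (p := p)
      have hr' := Ioo_subset_Icc_self hr
      rw [phi_deriv01_eq hp hphi hpos heq hv0 hWc hW hVc hV hr', ← neg_mul]
      exact mul_nonneg (neg_nonneg.2 hμ) (mul_nonneg hr'.1 (radialMean_nonneg
        (density_nonneg hw (nonneg_of_pos_of_zero hpos hv1) hW hV) hr'))
  have := hmono (left_mem_Icc.2 zero_le_one) (right_mem_Icc.2 zero_le_one) zero_le_one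
  linarith [hpos 0 (left_mem_Ico.2 zero_lt_one)]

/-- A principal eigenfunction is a fixed point of `radialPotential`. -/
lemma IsPrincipalEigenpair.eq_radialPotential (hp : 1 < p) (hw : ∀ r ∈ Icc (0:ℝ) 1, 0 < w r)
    (h : IsPrincipalEigenpair p N w μ v) (hWc : Continuous W) (hW : EqOn W w (Icc 0 1))
    (hVc : Continuous V) (hV : EqOn V v (Icc 0 1)) {r : ℝ} (hr : r ∈ Icc (0:ℝ) 1) :
    V r = radialPotential (p - 1) (N - 1) (fun t => μ * W t * V t ^ (p - 1)) r := by
  obtain ⟨hμ, hv, hphi, hpos, heq, hv0, hv1⟩ := h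
  have hα := sub_pos.2 hp
  have hμW : Continuous fun t => μ * W t := by fun_prop
  have hflux := continuous_radialFlux (n := N - 1) hα (continuous_weight_mul_rpow hα hμW hVc)
  have hderiv : ∀ s ∈ Icc (0:ℝ) 1, deriv01 v s =
      -(s * radialMean (N - 1) (fun t => μ * W t * V t ^ (p - 1)) s) ^ (p - 1)⁻¹ := by
    intro s hs
    have hnn := mul_nonneg hs.1 (radialMean_nonneg (n := N - 1)
      (density_nonneg (α := p - 1) hw (nonneg_of_pos_of_zero hpos hv1) hW hV) hs)
    have hmean : s * radialMean (N - 1) (fun t => μ * W t * V t ^ (p - 1)) s =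
        μ * (s * radialMean (N - 1) (fun t => W t * V t ^ (p - 1)) s) := by
      simp only [mul_assoc, radialMean_const_mul]
      ring
    rw [hmean]
    exact eq_neg_rpow_inv_of_phi_eq hp (mul_nonneg hμ.le hnn)
      (phi_deriv01_eq hp hphi hpos heq hv0 hWc hW hVc hV hs)
  have hFTC := intervalIntegral.integral_eq_sub_of_hasDerivAt_of_le hr.2 (f := v)
    (f' := fun s => -(s * radialMean (N - 1) (fun t => μ * W t * V t ^ (p - 1)) s) ^ (p - 1)⁻¹)
    (hv.continuousOn.mono (Icc_subset_Icc_left hr.1))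
    (fun s hs => by
      have hs' : s ∈ Ioo (0:ℝ) 1 := ⟨hr.1.trans_lt hs.1, hs.2⟩
      rw [← hderiv s (Ioo_subset_Icc_self hs')]
      exact hv.hasDerivAt hs')
    (hflux.neg.intervalIntegrable _ _)
  rw [intervalIntegral.integral_neg, hv1, zero_sub, neg_inj] at hFTC
  rw [hV hr, ← hFTC, radialPotential]

/-- A positive fixed point of `radialPotential` is a principal eigenfunction. -/
lemma isPrincipalEigenpair_of_eq_radialPotential (hp : 1 < p)
    (hw : ∀ r ∈ Icc (0:ℝ) 1, 0 < w r) (hWc : Continuous W) (hW : EqOn W w (Icc 0 1))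
    (hVc : Continuous V) (hV0 : 0 < V 0) (hVnn : ∀ r ∈ Icc (0:ℝ) 1, 0 ≤ V r) (hμ : 0 < μ)
    (hfix : ∀ r ∈ Icc (0:ℝ) 1,
      V r = radialPotential (p - 1) (N - 1) (fun t => μ * W t * V t ^ (p - 1)) r) :
    IsPrincipalEigenpair p N w μ V := by
  have hα := sub_pos.2 hp
  have h0 : (0:ℝ) ∈ Icc (0:ℝ) 1 := left_mem_Icc.2 zero_le_one
  have h1 : (1:ℝ) ∈ Icc (0:ℝ) 1 := right_mem_Icc.2 zero_le_one
  set g : ℝ → ℝ := fun t => μ * W t * V t ^ (p - 1) with hg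
  have hgc : Continuous g :=
    continuous_weight_mul_rpow hα (W := fun t => μ * W t) (by fun_prop) hVc
  have hgnn : ∀ t ∈ Icc (0:ℝ) 1, 0 ≤ g t := fun t ht => by
    have := density_nonneg (α := p - 1) hw hVnn hW (eqOn_refl V _) t ht
    rw [hg]
    simp only [mul_assoc]
    exact mul_nonneg hμ.le this
  have hmean := continuous_radialMean (n := N - 1) hgc
  obtain ⟨hVC1, hderiv⟩ := c1on01_of_hasDerivWithinAt
    (fun r hr => ((hasDerivAt_radialPotential (n := N - 1) hα hgc r).hasDerivWithinAt
      (s := Icc 0 1)).congr hfix (hfix r hr))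
    (continuous_radialFlux hα hgc).neg.continuousOn
  have hphi : EqOn (fun r => phi p (deriv01 V r)) (fun r => -(r * radialMean (N - 1) g r))
      (Icc 0 1) := fun r hr => by
    simp only [hderiv hr]
    exact phi_neg_rpow_inv hp (mul_nonneg hr.1 (radialMean_nonneg hgnn hr))
  obtain ⟨hphiC1, _⟩ := c1on01_of_hasDerivWithinAt
    (fun r hr => ((hasDerivAt_mul_radialMean (n := N - 1) hgc r).neg.hasDerivWithinAt
      (s := Icc 0 1)).congr hphi (hphi hr))
    (by fun_prop)
  refine ⟨hμ, hVC1, hphiC1, fun r hr => ?_, fun r hr => ?_, ?_, ?_⟩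
  · rw [hfix r (Ico_subset_Icc_self hr)]
    refine radialPotential_pos hα hgc hgnn ⟨0, h0, ?_⟩ hr
    exact mul_pos (mul_pos hμ (hW h0 ▸ hw 0 h0)) (Real.rpow_pos_of_pos hV0 _)
  · have hr' := Ioo_subset_Icc_self hr
    have hd : HasDerivAt (fun s => -∫ t in (0:ℝ)..s, t ^ (N - 1) * g t) (-(r ^ (N - 1) * g r)) r :=
      (Continuous.integral_hasStrictDerivAt (f := fun t => t ^ (N - 1) * g t)
        (by fun_prop) 0 r).hasDerivAt.neg
    have hval : μ * r ^ (N - 1) * w r * phi p (V r) = r ^ (N - 1) * g r := by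
      rw [phi_of_nonneg hp (hVnn r hr'), ← hW hr']
      ring
    rw [hval]
    refine hd.congr_of_eventuallyEq ?_
    filter_upwards [Icc_mem_nhds hr.1 hr.2] with s hs
    have := hphi hs
    simp only at this
    rw [this, ← pow_mul_mul_radialMean, mul_neg]
  · rw [hderiv h0]
    simp [Real.zero_rpow (inv_pos.2 hα).ne']
  · rw [hfix 1 h1, radialPotential_one]

lemma exists_isPrincipalEigenpair (hp : 1 < p) (hwc : ContinuousOn w (Icc 0 1))
    (hw : ∀ r ∈ Icc (0:ℝ) 1, 0 < w r) : ∃ μ v, IsPrincipalEigenpair p N w μ v := by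
  have hα := sub_pos.2 hp
  obtain ⟨W, hWc, hW⟩ := exists_continuous_eqOn_unit hwc
  obtain ⟨u, a, ha, huc, hunn, hu0, hfix⟩ := exists_eigenfunction (n := N - 1) hα hWc
    fun t ht => (hW ht).symm ▸ hw t ht
  have ha' := inv_pos.2 ha
  refine ⟨a⁻¹ ^ (p - 1), u, isPrincipalEigenpair_of_eq_radialPotential hp hw hWc hW huc
    (hu0 ▸ zero_lt_one) hunn (Real.rpow_pos_of_pos ha' _) fun r hr => ?_⟩
  simp only [mul_assoc]
  rw [radialPotential_rpow_mul hα (density_nonneg hw hunn hW (eqOn_refl u _)) ha'.le hr,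
    ← hfix r hr, inv_mul_cancel_left₀ ha.ne']

/-- If the weighted eigenvalues `μ₂ w₂ ≤ μ₁ w₁` are ordered, then they coincide. -/
lemma IsPrincipalEigenpair.eqOn_of_le {w₁ w₂ v₁ v₂ : ℝ → ℝ} {μ₁ μ₂ : ℝ} (hp : 1 < p)
    (hwc₁ : ContinuousOn w₁ (Icc 0 1)) (hwc₂ : ContinuousOn w₂ (Icc 0 1))
    (hw₁ : ∀ r ∈ Icc (0:ℝ) 1, 0 < w₁ r) (hw₂ : ∀ r ∈ Icc (0:ℝ) 1, 0 < w₂ r)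
    (h₁ : IsPrincipalEigenpair p N w₁ μ₁ v₁) (h₂ : IsPrincipalEigenpair p N w₂ μ₂ v₂)
    (hle : ∀ r ∈ Icc (0:ℝ) 1, μ₂ * w₂ r ≤ μ₁ * w₁ r) :
    EqOn (fun r => μ₂ * w₂ r) (fun r => μ₁ * w₁ r) (Icc 0 1) := by
  obtain ⟨W₁, hWc₁, hW₁⟩ := exists_continuous_eqOn_unit hwc₁
  obtain ⟨W₂, hWc₂, hW₂⟩ := exists_continuous_eqOn_unit hwc₂
  obtain ⟨V₁, hVc₁, hV₁⟩ := exists_continuous_eqOn_unit h₁.2.1.continuousOn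
  obtain ⟨V₂, hVc₂, hV₂⟩ := exists_continuous_eqOn_unit h₂.2.1.continuousOn
  have hIoo := weight_eqOn_of_le (sub_pos.2 hp) (W₁ := fun r => μ₁ * W₁ r)
    (W₂ := fun r => μ₂ * W₂ r) (by fun_prop) (by fun_prop)
    (fun t ht => by
      rw [hW₂ ht]
      exact mul_nonneg h₂.1.le (hw₂ t ht).le)
    (fun t ht => by
      rw [hW₂ ht, hW₁ ht]
      exact hle t ht) hVc₁ hVc₂
    (fun r hr => by
      rw [hV₁ (Ico_subset_Icc_self hr)]
      exact h₁.2.2.2.1 r hr)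
    (fun r hr => by
      rw [hV₂ (Ico_subset_Icc_self hr)]
      exact h₂.2.2.2.1 r hr)
    (fun r hr => h₁.eq_radialPotential hp hw₁ hWc₁ hW₁ hVc₁ hV₁ hr)
    (fun r hr => h₂.eq_radialPotential hp hw₂ hWc₂ hW₂ hVc₂ hV₂ hr)
  have hIcc := hIoo.closure (by fun_prop) (by fun_prop)
  rw [closure_Ioo zero_ne_one] at hIcc
  intro r hr
  simpa only [hW₁ hr, hW₂ hr] using hIcc hr

lemma IsPrincipalEigenpair.eigenvalue_le {v₁ v₂ : ℝ → ℝ} {μ₁ μ₂ : ℝ} (hp : 1 < p)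
    (hwc : ContinuousOn w (Icc 0 1)) (hw : ∀ r ∈ Icc (0:ℝ) 1, 0 < w r)
    (h₁ : IsPrincipalEigenpair p N w μ₁ v₁) (h₂ : IsPrincipalEigenpair p N w μ₂ v₂) :
    μ₁ ≤ μ₂ := by
  by_contra! hlt
  have h0 : (0:ℝ) ∈ Icc (0:ℝ) 1 := left_mem_Icc.2 zero_le_one
  have heq := h₁.eqOn_of_le hp hwc hwc hw hw h₂
    (fun r hr => mul_le_mul_of_nonneg_right hlt.le (hw r hr).le) h0
  exact hlt.ne (mul_right_cancel₀ (hw 0 h0).ne' heq)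

end Eigenpair

/-- existence of a principal eigenpair, uniqueness of the eigenvalue among
pairs with a positive eigenfunction, and strict monotone dependence of the principal
eigenvalue on the weight. -/
theorem stmt_0 (p : ℝ) (hp : 1 < p) (N : ℕ) (hN : 1 ≤ N)
    (w : ℝ → ℝ) (hw_cont : ContinuousOn w (Set.Icc 0 1))
    (hw_pos : ∀ r ∈ Set.Icc (0:ℝ) 1, 0 < w r) :
    -- (a) and (b): existence of a principal eigenpair, and any pair (μ, v) with a
    -- positive eigenfunction has μ equal to the principal eigenvalue
    (∃ lamw vw, IsPrincipalEigenpair p N w lamw vw ∧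
      ∀ (μ : ℝ) (v : ℝ → ℝ),
        C1on01 v → C1on01 (fun r => phi p (deriv01 v r)) →
        Nontriv01 v → (∀ r ∈ Set.Ico (0:ℝ) 1, 0 < v r) →
        (∀ r ∈ Set.Ioo (0:ℝ) 1,
          HasDerivAt (fun s => s ^ (N - 1) * phi p (deriv01 v s))
            (-(μ * r ^ (N - 1) * w r * phi p (v r))) r) →
        deriv01 v 0 = 0 → v 1 = 0 → μ = lamw) ∧
    -- (c): comparison of principal eigenvalues
    (∀ w₁ w₂ : ℝ → ℝ, ContinuousOn w₁ (Set.Icc 0 1) → ContinuousOn w₂ (Set.Icc 0 1) →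
      (∀ r ∈ Set.Icc (0:ℝ) 1, 0 < w₁ r) → (∀ r ∈ Set.Icc (0:ℝ) 1, 0 < w₂ r) →
      (∀ r ∈ Set.Icc (0:ℝ) 1, w₂ r ≤ w₁ r) → (∃ r ∈ Set.Icc (0:ℝ) 1, w₂ r ≠ w₁ r) →
      ∀ (lam₁ v₁ lam₂ v₂ : _), IsPrincipalEigenpair p N w₁ lam₁ v₁ →
        IsPrincipalEigenpair p N w₂ lam₂ v₂ → lam₁ < lam₂) := by
  refine ⟨?_, ?_⟩
  · obtain ⟨lamw, vw, hpair⟩ := exists_isPrincipalEigenpair (N := N) hp hw_cont hw_pos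
    refine ⟨lamw, vw, hpair, fun μ v hv hphi _ hpos heq hv0 hv1 => ?_⟩
    have hμ : IsPrincipalEigenpair p N w μ v :=
      ⟨eigenvalue_pos hp hw_cont hw_pos hv hphi hpos heq hv0 hv1, hv, hphi, hpos, heq, hv0, hv1⟩
    exact le_antisymm (hμ.eigenvalue_le hp hw_cont hw_pos hpair)
      (hpair.eigenvalue_le hp hw_cont hw_pos hμ)
  · intro w₁ w₂ hc₁ hc₂ hw₁ hw₂ hle hne lam₁ v₁ lam₂ v₂ h₁ h₂
    obtain ⟨r, hr, hne⟩ := hne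
    by_contra! hlam
    have heq := h₁.eqOn_of_le hp hc₁ hc₂ hw₁ hw₂ h₂
      (fun t ht => mul_le_mul hlam (hle t ht) (hw₂ t ht).le h₁.1.le) hr
    have hlt : w₂ r < w₁ r := lt_of_le_of_ne (hle r hr) hne
    have : lam₂ * w₂ r < lam₁ * w₁ r :=
      (mul_lt_mul_of_pos_left hlt h₂.1).trans_le (mul_le_mul_of_nonneg_right hlam (hw₁ r hr).le)
    exact this.ne heq
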